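/- The nonlocal function γ₄ = (1/(2c₁²u_x³))·Σ_{i=1,2} [((c₁²-4c₀u)u p_i² + 2c₁(c₁u+2c₀)p_i + c₁²u)u_xx + ((8c₀u-c₁²)p_i² - 2c₁²p_i - c₁²)u_x²]·exp(2z_i) is a nonlocal cosymmetry of the Krichever–Novikov equation: D_t(γ₄) + Σ_k (-D_x)^k((∂G₁/∂u_{kx})γ₄) = 0, with total derivatives extended to the nonlocal variables by the covering equations. -/

import Mathlib

noncomputable section

open Real

/-- Total `x`-derivative (on solutions: partial derivative in `x`). -/
def Dx (f : ℝ → ℝ → ℝ) : ℝ → ℝ → ℝ := fun x t => deriv (fun y => f y t) x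

/-- Total `t`-derivative (on solutions: partial derivative in `t`). -/
def Dt (f : ℝ → ℝ → ℝ) : ℝ → ℝ → ℝ := fun x t => deriv (fun s => f x s) t

/-- The cubic polynomial `P(u) = u³ + c₁ u + c₀`. -/
def Pcub (c₀ c₁ v : ℝ) : ℝ := v ^ 3 + c₁ * v + c₀

/-- `P′(u) = 3u² + c₁`. -/
def Pder (c₁ v : ℝ) : ℝ := 3 * v ^ 2 + c₁

/-- Right-hand side of the Krichever–Novikov equation. -/
def G1 (c₀ c₁ : ℝ) (u : ℝ → ℝ → ℝ) : ℝ → ℝ → ℝ := fun x t =>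
  Dx (Dx (Dx u)) x t - (3 / 2) * (Dx (Dx u) x t) ^ 2 / Dx u x t
    + Pcub c₀ c₁ (u x t) / Dx u x t

/-- Fréchet derivative of `G₁` applied to `G`:
`(G₁)⋆(G) = Σ_k (∂G₁/∂u_{kx}) Dₓᵏ(G)` with the explicit partial derivatives
`∂G₁/∂u = P′/u_x`, `∂G₁/∂u_x = (3/2)u_xx²/u_x² - P/u_x²`,
`∂G₁/∂u_xx = -3u_xx/u_x`, `∂G₁/∂u_xxx = 1`. -/
def FrG1 (c₀ c₁ : ℝ) (u G : ℝ → ℝ → ℝ) : ℝ → ℝ → ℝ := fun x t =>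
  (Pder c₁ (u x t) / Dx u x t) * G x t
    + ((3 / 2) * (Dx (Dx u) x t) ^ 2 / (Dx u x t) ^ 2
        - Pcub c₀ c₁ (u x t) / (Dx u x t) ^ 2) * Dx G x t
    + (-(3 * Dx (Dx u) x t) / Dx u x t) * Dx (Dx G) x t
    + Dx (Dx (Dx G)) x t

/-- Coefficient `k₁` of the covering. -/
def k1 (c₀ c₁ : ℝ) (u : ℝ → ℝ → ℝ) : ℝ → ℝ → ℝ := fun x t =>
  -(Real.sqrt 6 * (c₁ * u x t + 2 * c₀)) / (12 * Real.sqrt c₀ * Dx u x t)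

/-- Coefficient `k₂` of the covering. -/
def k2 (c₀ c₁ : ℝ) (u : ℝ → ℝ → ℝ) : ℝ → ℝ → ℝ := fun x t =>
  Real.sqrt 6 * c₁ * u x t / (12 * Real.sqrt c₀ * Dx u x t)

/-- Coefficient `k₃` of the covering. -/
def k3 (c₀ c₁ : ℝ) (u : ℝ → ℝ → ℝ) : ℝ → ℝ → ℝ := fun x t =>
  Real.sqrt 6 * u x t * (4 * c₀ * u x t - c₁ ^ 2) / (12 * c₁ * Real.sqrt c₀ * Dx u x t)

/-- Coefficient `m` of the covering. -/
def mco (c₀ c₁ : ℝ) (u : ℝ → ℝ → ℝ) : ℝ → ℝ → ℝ := fun x t =>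
  2 * (c₁ ^ 2 - 8 * c₀ * u x t - 2 * c₁ * (u x t) ^ 2) / (3 * c₁ * Dx u x t)

/-- Coefficient `l₁` of the covering. -/
def l1 (c₀ c₁ : ℝ) (u : ℝ → ℝ → ℝ) : ℝ → ℝ → ℝ := fun x t =>
  -(Real.sqrt 6 / (72 * Real.sqrt c₀ * (Dx u x t) ^ 3)) *
    (-(6 * c₁ * u x t * Dx u x t * Dx (Dx (Dx u)) x t)
      - 12 * c₀ * Dx u x t * Dx (Dx (Dx u)) x t
      + 3 * c₁ * u x t * (Dx (Dx u) x t) ^ 2 + 6 * c₀ * (Dx (Dx u) x t) ^ 2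
      + 12 * c₁ * (Dx u x t) ^ 2 * Dx (Dx u) x t
      + 4 * Real.sqrt 6 * Real.sqrt c₀ * (u x t) ^ 2 * (Dx u x t) ^ 2
      - 2 * c₁ * (u x t) ^ 4 - 4 * c₀ * (u x t) ^ 3 - 2 * c₁ ^ 2 * (u x t) ^ 2
      - 6 * c₀ * c₁ * u x t - 4 * c₀ ^ 2)

/-- Coefficient `l₂` of the covering. -/
def l2 (c₀ c₁ : ℝ) (u : ℝ → ℝ → ℝ) : ℝ → ℝ → ℝ := fun x t =>
  Real.sqrt 6 * c₁ / (72 * Real.sqrt c₀ * (Dx u x t) ^ 3) *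
    (-(6 * u x t * Dx u x t * Dx (Dx (Dx u)) x t)
      + 3 * u x t * (Dx (Dx u) x t) ^ 2 + 12 * (Dx u x t) ^ 2 * Dx (Dx u) x t
      + 4 * Real.sqrt 6 * Real.sqrt c₀ * (Dx u x t) ^ 2
      - 2 * (u x t) ^ 4 - 2 * c₁ * (u x t) ^ 2 - 2 * c₀ * u x t)

/-- Coefficient `l₃` of the covering. -/
def l3 (c₀ c₁ : ℝ) (u : ℝ → ℝ → ℝ) : ℝ → ℝ → ℝ := fun x t =>
  -(Real.sqrt 6 / (72 * c₁ * Real.sqrt c₀ * (Dx u x t) ^ 3)) *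
    (-(6 * c₁ ^ 2 * u x t * Dx u x t * Dx (Dx (Dx u)) x t)
      + 24 * c₀ * (u x t) ^ 2 * Dx u x t * Dx (Dx (Dx u)) x t
      + 3 * c₁ ^ 2 * u x t * (Dx (Dx u) x t) ^ 2
      - 12 * c₀ * (u x t) ^ 2 * (Dx (Dx u) x t) ^ 2
      + 12 * c₁ ^ 2 * (Dx u x t) ^ 2 * Dx (Dx u) x t
      - 96 * c₀ * u x t * (Dx u x t) ^ 2 * Dx (Dx u) x t
      + 96 * c₀ * (Dx u x t) ^ 4
      - 4 * Real.sqrt 6 * Real.sqrt c₀ * c₁ ^ 2 * (Dx u x t) ^ 2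
      + 32 * Real.sqrt 6 * (c₀ * Real.sqrt c₀) * u x t * (Dx u x t) ^ 2
      + 8 * Real.sqrt 6 * Real.sqrt c₀ * c₁ * (u x t) ^ 2 * (Dx u x t) ^ 2
      + 8 * c₀ * (u x t) ^ 5 - 2 * c₁ ^ 2 * (u x t) ^ 4 + 8 * c₀ * c₁ * (u x t) ^ 3
      - 2 * c₁ ^ 3 * (u x t) ^ 2 + 8 * c₀ ^ 2 * (u x t) ^ 2 - 2 * c₀ * c₁ ^ 2 * u x t)

/-- The nonlocal function `γ₄`. -/
def gamma4 (c₀ c₁ : ℝ) (u p1 z1 p2 z2 : ℝ → ℝ → ℝ) : ℝ → ℝ → ℝ := fun x t =>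
  (1 / (2 * c₁ ^ 2 * (Dx u x t) ^ 3)) *
    ((((c₁ ^ 2 - 4 * c₀ * u x t) * u x t * (p1 x t) ^ 2
        + 2 * c₁ * (c₁ * u x t + 2 * c₀) * p1 x t + c₁ ^ 2 * u x t) * Dx (Dx u) x t
      + ((8 * c₀ * u x t - c₁ ^ 2) * (p1 x t) ^ 2 - 2 * c₁ ^ 2 * p1 x t - c₁ ^ 2)
          * (Dx u x t) ^ 2) * Real.exp (2 * z1 x t)
    + (((c₁ ^ 2 - 4 * c₀ * u x t) * u x t * (p2 x t) ^ 2
        + 2 * c₁ * (c₁ * u x t + 2 * c₀) * p2 x t + c₁ ^ 2 * u x t) * Dx (Dx u) x t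
      + ((8 * c₀ * u x t - c₁ ^ 2) * (p2 x t) ^ 2 - 2 * c₁ ^ 2 * p2 x t - c₁ ^ 2)
          * (Dx u x t) ^ 2) * Real.exp (2 * z2 x t))

/-- Formal adjoint of the Fréchet derivative of `G₁` applied to `γ`:
`(G₁)⋆†(γ) = Σ_k (-Dₓ)ᵏ((∂G₁/∂u_{kx}) γ)`. -/
def adjFrG1 (c₀ c₁ : ℝ) (u γ : ℝ → ℝ → ℝ) : ℝ → ℝ → ℝ := fun x t =>
  (Pder c₁ (u x t) / Dx u x t) * γ x t
    - Dx (fun x t =>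
        ((3 / 2) * (Dx (Dx u) x t) ^ 2 / (Dx u x t) ^ 2
          - Pcub c₀ c₁ (u x t) / (Dx u x t) ^ 2) * γ x t) x t
    + Dx (Dx (fun x t => (-(3 * Dx (Dx u) x t) / Dx u x t) * γ x t)) x t
    - Dx (Dx (Dx γ)) x t

/-- `f'` is the `x`-derivative of `f` at every point. -/
def HasDx (f f' : ℝ → ℝ → ℝ) : Prop :=
  ∀ x t, HasDerivAt (fun y => f y t) (f' x t) x

/-- `f'` is the `t`-derivative of `f` at every point. -/
def HasDt (f f' : ℝ → ℝ → ℝ) : Prop :=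
  ∀ x t, HasDerivAt (fun s => f x s) (f' x t) t

theorem HasDx.Dx_eq {f f' : ℝ → ℝ → ℝ} (h : HasDx f f') : Dx f = f' :=
  funext fun x => funext fun t => (h x t).deriv

theorem HasDt.Dt_eq {f f' : ℝ → ℝ → ℝ} (h : HasDt f f') : Dt f = f' :=
  funext fun x => funext fun t => (h x t).deriv

section Smooth

variable {f : ℝ → ℝ → ℝ}

theorem hasDx_fderiv (hf : ContDiff ℝ (⊤ : ℕ∞) (Function.uncurry f)) :
    HasDx f fun x t => fderiv ℝ (Function.uncurry f) (x, t) (1, 0) := fun x t =>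
  (hf.differentiable (by simp) (x, t)).hasFDerivAt.comp_hasDerivAt (f := fun y => (y, t)) x
    ((hasDerivAt_id x).prodMk (hasDerivAt_const x t))

theorem hasDt_fderiv (hf : ContDiff ℝ (⊤ : ℕ∞) (Function.uncurry f)) :
    HasDt f fun x t => fderiv ℝ (Function.uncurry f) (x, t) (0, 1) := fun x t =>
  (hf.differentiable (by simp) (x, t)).hasFDerivAt.comp_hasDerivAt (f := fun s => (x, s)) t
    ((hasDerivAt_const t x).prodMk (hasDerivAt_id t))

theorem hasDx_Dx (hf : ContDiff ℝ (⊤ : ℕ∞) (Function.uncurry f)) : HasDx f (Dx f) := by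
  rw [(hasDx_fderiv hf).Dx_eq]
  exact hasDx_fderiv hf

theorem hasDt_Dt (hf : ContDiff ℝ (⊤ : ℕ∞) (Function.uncurry f)) : HasDt f (Dt f) := by
  rw [(hasDt_fderiv hf).Dt_eq]
  exact hasDt_fderiv hf

theorem contDiff_fderiv_apply (hf : ContDiff ℝ (⊤ : ℕ∞) (Function.uncurry f)) (v : ℝ × ℝ) :
    ContDiff ℝ (⊤ : ℕ∞) fun q => fderiv ℝ (Function.uncurry f) q v :=
  (hf.fderiv_right (by norm_cast)).clm_apply contDiff_const

theorem contDiff_Dx (hf : ContDiff ℝ (⊤ : ℕ∞) (Function.uncurry f)) :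
    ContDiff ℝ (⊤ : ℕ∞) (Function.uncurry (Dx f)) := by
  rw [(hasDx_fderiv hf).Dx_eq]
  exact contDiff_fderiv_apply hf (1, 0)

theorem Dt_Dx_comm (hf : ContDiff ℝ (⊤ : ℕ∞) (Function.uncurry f)) :
    Dt (Dx f) = Dx (Dt f) := by
  have hd : ∀ q, DifferentiableAt ℝ (fderiv ℝ (Function.uncurry f)) q :=
    (hf.fderiv_right (m := 1) (by norm_cast)).differentiable (by simp)
  rw [(hasDx_fderiv hf).Dx_eq, (hasDt_fderiv hf).Dt_eq]
  funext x t
  have h1 := hasDt_fderiv (f := fun x t => fderiv ℝ (Function.uncurry f) (x, t) (1, 0))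
    (contDiff_fderiv_apply hf (1, 0))
  have h2 := hasDx_fderiv (f := fun x t => fderiv ℝ (Function.uncurry f) (x, t) (0, 1))
    (contDiff_fderiv_apply hf (0, 1))
  rw [h1.Dt_eq, h2.Dx_eq]
  have key : ∀ v w : ℝ × ℝ, fderiv ℝ (fun q => fderiv ℝ (Function.uncurry f) q v) (x, t) w
      = fderiv ℝ (fderiv ℝ (Function.uncurry f)) (x, t) w v := fun v w => by
    rw [fderiv_clm_apply (hd _) (differentiableAt_const v)]
    simp
  have symm : IsSymmSndFDerivAt ℝ (Function.uncurry f) (x, t) :=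
    hf.contDiffAt.isSymmSndFDerivAt (by simpa using (by norm_cast : (2 : WithTop ℕ∞) ≤ ((⊤ : ℕ∞) :
    WithTop ℕ∞)))
  exact (key (1, 0) (0, 1)).trans ((symm.eq _ _).trans (key (0, 1) (1, 0)).symm)

end Smooth

section Jets

variable {c₀ c₁ : ℝ} {u u₁ u₂ u₃ u₄ u₅ : ℝ → ℝ → ℝ}

theorem hasDx_G1 (hu₁ : ∀ x t, u₁ x t ≠ 0) (h0 : HasDx u u₁) (h1 : HasDx u₁ u₂)
    (h2 : HasDx u₂ u₃) (h3 : HasDx u₃ u₄) :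
    HasDx (G1 c₀ c₁ u) fun x t =>
      u₄ x t - 3 * u₂ x t * u₃ x t / u₁ x t + 3 / 2 * u₂ x t ^ 3 / u₁ x t ^ 2
        + Pder c₁ (u x t) - Pcub c₀ c₁ (u x t) * u₂ x t / u₁ x t ^ 2 := by
  intro x t
  unfold G1
  rw [h0.Dx_eq, h1.Dx_eq, h2.Dx_eq]
  have hx := hu₁ x t
  unfold Pcub Pder
  apply HasDerivAt.congr_deriv
  · repeat' first
      | exact h0 x t | exact h1 x t | exact h2 x t | exact h3 x t
      | exact hx | exact pow_ne_zero _ hx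
      | exact hasDerivAt_const _ _
      | with_reducible apply HasDerivAt.fun_add | with_reducible apply HasDerivAt.fun_sub
      | with_reducible apply HasDerivAt.fun_neg
      | with_reducible apply HasDerivAt.fun_mul | with_reducible apply HasDerivAt.fun_div
      | with_reducible apply HasDerivAt.fun_pow
  · field_simp
    ring

theorem hasDx_Dx_G1 (hu₁ : ∀ x t, u₁ x t ≠ 0) (h0 : HasDx u u₁) (h1 : HasDx u₁ u₂)
    (h2 : HasDx u₂ u₃) (h3 : HasDx u₃ u₄) (h4 : HasDx u₄ u₅) :
    HasDx (Dx (G1 c₀ c₁ u)) fun x t =>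
      u₅ x t - 3 * (u₃ x t ^ 2 + u₂ x t * u₄ x t) / u₁ x t
        + 15 / 2 * u₂ x t ^ 2 * u₃ x t / u₁ x t ^ 2 - 3 * u₂ x t ^ 4 / u₁ x t ^ 3
        + 6 * u x t * u₁ x t - Pder c₁ (u x t) * u₂ x t / u₁ x t
        - Pcub c₀ c₁ (u x t) * (u₃ x t / u₁ x t ^ 2 - 2 * u₂ x t ^ 2 / u₁ x t ^ 3) := by
  intro x t
  rw [(hasDx_G1 hu₁ h0 h1 h2 h3).Dx_eq]
  have hx := hu₁ x t
  unfold Pcub Pder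
  apply HasDerivAt.congr_deriv
  · repeat' first
      | exact h0 x t | exact h1 x t | exact h2 x t | exact h3 x t | exact h4 x t
      | exact hx | exact pow_ne_zero _ hx
      | exact hasDerivAt_const _ _
      | with_reducible apply HasDerivAt.fun_add | with_reducible apply HasDerivAt.fun_sub
      | with_reducible apply HasDerivAt.fun_neg
      | with_reducible apply HasDerivAt.fun_mul | with_reducible apply HasDerivAt.fun_div
      | with_reducible apply HasDerivAt.fun_pow
  · field_simp
    ring

/-- The adjoint linearization, expanded by the Leibniz rule. -/
theorem adjFrG1_eq {γ γ₁ γ₂ γ₃ : ℝ → ℝ → ℝ} (hu₁ : ∀ x t, u₁ x t ≠ 0) (h0 : HasDx u u₁)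
    (h1 : HasDx u₁ u₂) (h2 : HasDx u₂ u₃) (h3 : HasDx u₃ u₄)
    (g0 : HasDx γ γ₁) (g1 : HasDx γ₁ γ₂) (g2 : HasDx γ₂ γ₃) (x t : ℝ) :
    adjFrG1 c₀ c₁ u γ x t =
      -γ₃ x t - 3 * u₂ x t / u₁ x t * γ₂ x t
        + (Pcub c₀ c₁ (u x t) / u₁ x t ^ 2 - 6 * u₃ x t / u₁ x t
          + 9 / 2 * u₂ x t ^ 2 / u₁ x t ^ 2) * γ₁ x t
        + (2 * Pder c₁ (u x t) / u₁ x t - 2 * Pcub c₀ c₁ (u x t) * u₂ x t / u₁ x t ^ 3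
          - 3 * u₄ x t / u₁ x t + 6 * u₂ x t * u₃ x t / u₁ x t ^ 2
          - 3 * u₂ x t ^ 3 / u₁ x t ^ 3) * γ x t := by
  have hA : HasDx
      (fun x t => (3 / 2 * u₂ x t ^ 2 / u₁ x t ^ 2 - Pcub c₀ c₁ (u x t) / u₁ x t ^ 2) * γ x t)
      fun x t =>
        (3 / 2 * u₂ x t ^ 2 / u₁ x t ^ 2 - Pcub c₀ c₁ (u x t) / u₁ x t ^ 2) * γ₁ x t
          + (3 * u₂ x t * u₃ x t / u₁ x t ^ 2 - 3 * u₂ x t ^ 3 / u₁ x t ^ 3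
            - Pder c₁ (u x t) / u₁ x t + 2 * Pcub c₀ c₁ (u x t) * u₂ x t / u₁ x t ^ 3)
            * γ x t := by
    intro x t
    have hx := hu₁ x t
    unfold Pcub Pder
    apply HasDerivAt.congr_deriv
    · repeat' first
        | exact h0 x t | exact h1 x t | exact h2 x t | exact g0 x t
        | exact hx | exact pow_ne_zero _ hx
        | exact hasDerivAt_const _ _
        | with_reducible apply HasDerivAt.fun_add | with_reducible apply HasDerivAt.fun_sub
        | with_reducible apply HasDerivAt.fun_neg
        | with_reducible apply HasDerivAt.fun_mul | with_reducible apply HasDerivAt.fun_div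
        | with_reducible apply HasDerivAt.fun_pow
    · field_simp
      ring
  have hH : HasDx (fun x t => -(3 * u₂ x t) / u₁ x t * γ x t) fun x t =>
      -(3 * u₂ x t) / u₁ x t * γ₁ x t
        + 3 * (u₂ x t ^ 2 / u₁ x t ^ 2 - u₃ x t / u₁ x t) * γ x t := by
    intro x t
    have hx := hu₁ x t
    apply HasDerivAt.congr_deriv
    · repeat' first
        | exact h1 x t | exact h2 x t | exact g0 x t
        | exact hx | exact pow_ne_zero _ hx
        | exact hasDerivAt_const _ _
        | with_reducible apply HasDerivAt.fun_add | with_reducible apply HasDerivAt.fun_sub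
        | with_reducible apply HasDerivAt.fun_neg
        | with_reducible apply HasDerivAt.fun_mul | with_reducible apply HasDerivAt.fun_div
    · field_simp
      ring
  have hHH : HasDx (Dx fun x t => -(3 * u₂ x t) / u₁ x t * γ x t) fun x t =>
      -(3 * u₂ x t) / u₁ x t * γ₂ x t
        + 6 * (u₂ x t ^ 2 / u₁ x t ^ 2 - u₃ x t / u₁ x t) * γ₁ x t
        + (9 * u₂ x t * u₃ x t / u₁ x t ^ 2 - 6 * u₂ x t ^ 3 / u₁ x t ^ 3
          - 3 * u₄ x t / u₁ x t) * γ x t := by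
    intro x t
    rw [hH.Dx_eq]
    have hx := hu₁ x t
    apply HasDerivAt.congr_deriv
    · repeat' first
        | exact h1 x t | exact h2 x t | exact h3 x t | exact g0 x t | exact g1 x t
        | exact hx | exact pow_ne_zero _ hx
        | exact hasDerivAt_const _ _
        | with_reducible apply HasDerivAt.fun_add | with_reducible apply HasDerivAt.fun_sub
        | with_reducible apply HasDerivAt.fun_neg
        | with_reducible apply HasDerivAt.fun_mul | with_reducible apply HasDerivAt.fun_div
        | with_reducible apply HasDerivAt.fun_pow
    · field_simp
      ring
  unfold adjFrG1
  rw [h0.Dx_eq, h1.Dx_eq, hA.Dx_eq, hHH.Dx_eq, g0.Dx_eq, g1.Dx_eq, g2.Dx_eq]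
  ring

/-- A linear system along a solution `u`, closed under the `x`- and `t`-derivatives needed for
the cosymmetry condition. In the applications `φ` is a quadratic in the nonlocal variable times an
exponential, `ψ` and `χ` come from differentiating the coefficients of `φ` in `u`, and `ω`, `θ`,
`ρ` are Wronskians in the nonlocal variable. -/
structure IsLinearSolution (c₀ c₁ : ℝ) (u u₁ u₂ u₃ φ ψ χ ω θ ρ : ℝ → ℝ → ℝ) : Prop where
  hφ : HasDx φ fun x t => u₁ x t * ψ x t
  hψ : HasDx ψ fun x t => u₁ x t * χ x t + ω x t / u₁ x t
  hχ : HasDx χ fun x t => θ x t / u₁ x t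
  hω : HasDx ω fun x t => u₁ x t * θ x t
    + 2 / 3 * (Pcub c₀ c₁ (u x t) * ψ x t - Pder c₁ (u x t) / 2 * φ x t) / u₁ x t
  hθ : HasDx θ fun x t => u₁ x t * ρ x t
    + 2 / 3 * (Pcub c₀ c₁ (u x t) * χ x t - u x t * φ x t) / u₁ x t
  hφt : HasDt φ fun x t => ψ x t * G1 c₀ c₁ u x t - 2 * u₂ x t / u₁ x t * ω x t
    + 2 * u₁ x t * θ x t
    - 4 / (3 * u₁ x t) * (Pcub c₀ c₁ (u x t) * ψ x t - Pder c₁ (u x t) / 2 * φ x t)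
  hψt : HasDt ψ fun x t => χ x t * G1 c₀ c₁ u x t
    + (3 * u₂ x t ^ 2 - 6 * u₁ x t * u₃ x t - 2 * Pcub c₀ c₁ (u x t))
      / (6 * u₁ x t ^ 3) * ω x t
    + 2 * u₁ x t * ρ x t
    + 4 / (3 * u₁ x t) * (2 * u x t * φ x t - Pder c₁ (u x t) / 2 * ψ x t)

theorem IsLinearSolution.add {φ ψ χ ω θ ρ φ' ψ' χ' ω' θ' ρ' : ℝ → ℝ → ℝ}
    (h : IsLinearSolution c₀ c₁ u u₁ u₂ u₃ φ ψ χ ω θ ρ)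
    (h' : IsLinearSolution c₀ c₁ u u₁ u₂ u₃ φ' ψ' χ' ω' θ' ρ') :
    IsLinearSolution c₀ c₁ u u₁ u₂ u₃ (fun x t => φ x t + φ' x t) (fun x t => ψ x t + ψ' x t)
      (fun x t => χ x t + χ' x t) (fun x t => ω x t + ω' x t) (fun x t => θ x t + θ' x t)
      (fun x t => ρ x t + ρ' x t) where
  hφ x t := ((h.hφ x t).fun_add (h'.hφ x t)).congr_deriv (by ring)
  hψ x t := ((h.hψ x t).fun_add (h'.hψ x t)).congr_deriv (by ring)
  hχ x t := ((h.hχ x t).fun_add (h'.hχ x t)).congr_deriv (by ring)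
  hω x t := ((h.hω x t).fun_add (h'.hω x t)).congr_deriv (by ring)
  hθ x t := ((h.hθ x t).fun_add (h'.hθ x t)).congr_deriv (by ring)
  hφt x t := ((h.hφt x t).fun_add (h'.hφt x t)).congr_deriv (by ring)
  hψt x t := ((h.hψt x t).fun_add (h'.hψt x t)).congr_deriv (by ring)

/-- A solution of the linear system yields a cosymmetry. -/
theorem IsLinearSolution.cosymmetry {φ ψ χ ω θ ρ : ℝ → ℝ → ℝ}
    (h : IsLinearSolution c₀ c₁ u u₁ u₂ u₃ φ ψ χ ω θ ρ)
    (hu : ContDiff ℝ (⊤ : ℕ∞) (Function.uncurry u)) (hKN : Dt u = G1 c₀ c₁ u)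
    (hu₁ : ∀ x t, u₁ x t ≠ 0) (h0 : HasDx u u₁) (h1 : HasDx u₁ u₂)
    (h2 : HasDx u₂ u₃) (h3 : HasDx u₃ u₄) (h4 : HasDx u₄ u₅) (x t : ℝ) :
    Dt (fun x t => ψ x t / u₁ x t - φ x t * u₂ x t / u₁ x t ^ 3) x t
      + adjFrG1 c₀ c₁ u (fun x t => ψ x t / u₁ x t - φ x t * u₂ x t / u₁ x t ^ 3) x t = 0 := by
  obtain ⟨hφ, hψ, hχ, hω, hθ, hφt, hψt⟩ := h
  have g0 : HasDx (fun x t => ψ x t / u₁ x t - φ x t * u₂ x t / u₁ x t ^ 3) fun x t =>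
      χ x t + ω x t / u₁ x t ^ 2 - 2 * ψ x t * u₂ x t / u₁ x t ^ 2
        - φ x t * (u₃ x t / u₁ x t ^ 3 - 3 * u₂ x t ^ 2 / u₁ x t ^ 4) := by
    intro x t
    have hx := hu₁ x t
    apply HasDerivAt.congr_deriv
    · repeat' first
        | exact h1 x t | exact h2 x t | exact hφ x t | exact hψ x t
        | exact hx | exact pow_ne_zero _ hx
        | exact hasDerivAt_const _ _
        | with_reducible apply HasDerivAt.fun_add | with_reducible apply HasDerivAt.fun_sub
        | with_reducible apply HasDerivAt.fun_neg
        | with_reducible apply HasDerivAt.fun_mul | with_reducible apply HasDerivAt.fun_div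
        | with_reducible apply HasDerivAt.fun_pow
    · field_simp
      ring
  have g1 : HasDx (fun x t => χ x t + ω x t / u₁ x t ^ 2 - 2 * ψ x t * u₂ x t / u₁ x t ^ 2
        - φ x t * (u₃ x t / u₁ x t ^ 3 - 3 * u₂ x t ^ 2 / u₁ x t ^ 4)) fun x t =>
      2 * θ x t / u₁ x t - 2 * χ x t * u₂ x t / u₁ x t - 4 * ω x t * u₂ x t / u₁ x t ^ 3
        + ψ x t * (2 / 3 * Pcub c₀ c₁ (u x t) / u₁ x t ^ 3 - 3 * u₃ x t / u₁ x t ^ 2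
          + 7 * u₂ x t ^ 2 / u₁ x t ^ 3)
        - φ x t * (1 / 3 * Pder c₁ (u x t) / u₁ x t ^ 3 + u₄ x t / u₁ x t ^ 3
          - 9 * u₂ x t * u₃ x t / u₁ x t ^ 4 + 12 * u₂ x t ^ 3 / u₁ x t ^ 5) := by
    intro x t
    have hx := hu₁ x t
    apply HasDerivAt.congr_deriv
    · repeat' first
        | exact h1 x t | exact h2 x t | exact h3 x t | exact hφ x t | exact hψ x t | exact hχ x t
        | exact hω x t
        | exact hx | exact pow_ne_zero _ hx
        | exact hasDerivAt_const _ _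
        | with_reducible apply HasDerivAt.fun_add | with_reducible apply HasDerivAt.fun_sub
        | with_reducible apply HasDerivAt.fun_neg
        | with_reducible apply HasDerivAt.fun_mul | with_reducible apply HasDerivAt.fun_div
        | with_reducible apply HasDerivAt.fun_pow
    · field_simp
      ring
  have g2 : HasDx (fun x t => 2 * θ x t / u₁ x t - 2 * χ x t * u₂ x t / u₁ x t
        - 4 * ω x t * u₂ x t / u₁ x t ^ 3
        + ψ x t * (2 / 3 * Pcub c₀ c₁ (u x t) / u₁ x t ^ 3 - 3 * u₃ x t / u₁ x t ^ 2
          + 7 * u₂ x t ^ 2 / u₁ x t ^ 3)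
        - φ x t * (1 / 3 * Pder c₁ (u x t) / u₁ x t ^ 3 + u₄ x t / u₁ x t ^ 3
          - 9 * u₂ x t * u₃ x t / u₁ x t ^ 4 + 12 * u₂ x t ^ 3 / u₁ x t ^ 5)) fun x t =>
      2 * ρ x t - 8 * θ x t * u₂ x t / u₁ x t ^ 2
        + χ x t * (2 * Pcub c₀ c₁ (u x t) / u₁ x t ^ 2 - 5 * u₃ x t / u₁ x t
          + 9 * u₂ x t ^ 2 / u₁ x t ^ 2)
        + ω x t * (2 / 3 * Pcub c₀ c₁ (u x t) / u₁ x t ^ 4 - 7 * u₃ x t / u₁ x t ^ 3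
          + 19 * u₂ x t ^ 2 / u₁ x t ^ 4)
        + ψ x t * (1 / 3 * Pder c₁ (u x t) / u₁ x t ^ 2
          - 14 / 3 * Pcub c₀ c₁ (u x t) * u₂ x t / u₁ x t ^ 4 - 4 * u₄ x t / u₁ x t ^ 2
          + 29 * u₂ x t * u₃ x t / u₁ x t ^ 3 - 33 * u₂ x t ^ 3 / u₁ x t ^ 4)
        - φ x t * (10 / 3 * u x t / u₁ x t ^ 2 - 7 / 3 * Pder c₁ (u x t) * u₂ x t / u₁ x t ^ 4
          + u₅ x t / u₁ x t ^ 3 - 12 * u₂ x t * u₄ x t / u₁ x t ^ 4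
          - 9 * u₃ x t ^ 2 / u₁ x t ^ 4 + 72 * u₂ x t ^ 2 * u₃ x t / u₁ x t ^ 5
          - 60 * u₂ x t ^ 4 / u₁ x t ^ 6) := by
    intro x t
    have hx := hu₁ x t
    unfold Pcub Pder at *
    apply HasDerivAt.congr_deriv
    · repeat' first
        | exact h0 x t | exact h1 x t | exact h2 x t | exact h3 x t | exact h4 x t | exact hφ x t
        | exact hψ x t | exact hχ x t | exact hω x t | exact hθ x t
        | exact hx | exact pow_ne_zero _ hx
        | exact hasDerivAt_const _ _
        | with_reducible apply HasDerivAt.fun_add | with_reducible apply HasDerivAt.fun_sub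
        | with_reducible apply HasDerivAt.fun_neg
        | with_reducible apply HasDerivAt.fun_mul | with_reducible apply HasDerivAt.fun_div
        | with_reducible apply HasDerivAt.fun_pow
    · field_simp
      ring
  have hu₁s : ContDiff ℝ (⊤ : ℕ∞) (Function.uncurry u₁) := h0.Dx_eq ▸ contDiff_Dx hu
  have hu₂s : ContDiff ℝ (⊤ : ℕ∞) (Function.uncurry u₂) := h1.Dx_eq ▸ contDiff_Dx hu₁s
  have hu₁t : Dt u₁ = Dx (G1 c₀ c₁ u) := by rw [← h0.Dx_eq, Dt_Dx_comm hu, hKN]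
  have hu₂t : Dt u₂ = Dx (Dx (G1 c₀ c₁ u)) := by rw [← h1.Dx_eq, Dt_Dx_comm hu₁s, hu₁t]
  have e1 := hasDt_Dt hu₁s
  have e2 := hasDt_Dt hu₂s
  rw [hu₁t, (hasDx_G1 hu₁ h0 h1 h2 h3).Dx_eq] at e1
  rw [hu₂t, (hasDx_Dx_G1 hu₁ h0 h1 h2 h3 h4).Dx_eq] at e2
  have hx := hu₁ x t
  rw [adjFrG1_eq hu₁ h0 h1 h2 h3 g0 g1 g2]
  unfold Dt
  rw [(((hψt x t).fun_div (e1 x t) hx).fun_sub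
    (((hφt x t).fun_mul (e2 x t)).fun_div ((e1 x t).fun_pow 3) (pow_ne_zero 3 hx))).deriv]
  unfold G1
  rw [h0.Dx_eq, h1.Dx_eq, h2.Dx_eq]
  field_simp
  ring

/-- The quadratic in `p` whose coefficients are those of the covering, with `u`-dependence. -/
def quad (c₀ c₁ v p : ℝ) : ℝ :=
  (c₁ ^ 2 - 4 * c₀ * v) * v * p ^ 2 + 2 * c₁ * (c₁ * v + 2 * c₀) * p + c₁ ^ 2 * v

/-- The `u`-derivative of `quad`. -/
def quadU (c₀ c₁ v p : ℝ) : ℝ :=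
  (c₁ ^ 2 - 8 * c₀ * v) * p ^ 2 + 2 * c₁ ^ 2 * p + c₁ ^ 2

/-- The Wronskian in `p` of `quadU` and `quad`, divided by `4 * c₀ * c₁`. -/
def quadW (c₀ c₁ v p : ℝ) : ℝ :=
  (2 * c₁ * v ^ 2 - c₁ ^ 2 + 8 * c₀ * v) * p ^ 2 + 2 * c₁ * v ^ 2 * p + c₁ ^ 2

/-- Solutions `p`, `z` of the covering with parameter `κ` give solutions of the linear system. -/
theorem isLinearSolution_of_covering {κ : ℝ} {p z : ℝ → ℝ → ℝ} (c : ℝ)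
    (hκ : 24 * c₁ ^ 2 * c₀ * κ ^ 2 = 1)
    (hux : HasDx u u₁) (hut : HasDt u (G1 c₀ c₁ u))
    (hpx : HasDx p fun x t => -κ * quad c₀ c₁ (u x t) (p x t) / u₁ x t)
    (hzx : HasDx z fun x t => κ * ((c₁ ^ 2 - 4 * c₀ * u x t) * u x t * p x t
      + c₁ * (c₁ * u x t + 2 * c₀)) / u₁ x t)
    (hpt : HasDt p fun x t =>
      -κ * ((3 * u₂ x t ^ 2 - 6 * u₁ x t * u₃ x t - 2 * Pcub c₀ c₁ (u x t))
          / (6 * u₁ x t ^ 3) * quad c₀ c₁ (u x t) (p x t)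
        + 2 * u₂ x t / u₁ x t * quadU c₀ c₁ (u x t) (p x t)
        + 16 * c₀ * u₁ x t * p x t ^ 2
        + 8 * κ * c₀ * c₁ / u₁ x t * quadW c₀ c₁ (u x t) (p x t)))
    (hzt : HasDt z fun x t =>
      κ * ((3 * u₂ x t ^ 2 - 6 * u₁ x t * u₃ x t - 2 * Pcub c₀ c₁ (u x t))
          / (6 * u₁ x t ^ 3) * ((c₁ ^ 2 - 4 * c₀ * u x t) * u x t * p x t
            + c₁ * (c₁ * u x t + 2 * c₀))
        + 2 * u₂ x t / u₁ x t * ((c₁ ^ 2 - 8 * c₀ * u x t) * p x t + c₁ ^ 2)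
        + 16 * c₀ * u₁ x t * p x t
        + 8 * κ * c₀ * c₁ / u₁ x t * ((2 * c₁ * u x t ^ 2 - c₁ ^ 2 + 8 * c₀ * u x t) * p x t
          + c₁ * u x t ^ 2))) :
    IsLinearSolution c₀ c₁ u u₁ u₂ u₃
      (fun x t => c * quad c₀ c₁ (u x t) (p x t) * exp (2 * z x t))
      (fun x t => c * quadU c₀ c₁ (u x t) (p x t) * exp (2 * z x t))
      (fun x t => c * (-8 * c₀ * p x t ^ 2) * exp (2 * z x t))
      (fun x t => c * κ * (4 * c₀ * c₁ * quadW c₀ c₁ (u x t) (p x t)) * exp (2 * z x t))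
      (fun x t => c * κ * (16 * c₀ * c₁ * ((c₁ * u x t + 2 * c₀) * p x t ^ 2
        + c₁ * u x t * p x t)) * exp (2 * z x t))
      (fun x t => c * κ * (16 * c₀ * c₁ ^ 2 * (p x t ^ 2 + p x t)) * exp (2 * z x t)) := by
  unfold quad quadU quadW at *
  constructor <;> intro x t
  · apply HasDerivAt.congr_deriv
    · repeat' first
        | exact hux x t | exact hpx x t | exact hzx x t
        | exact hasDerivAt_const _ _
        | with_reducible apply HasDerivAt.fun_add | with_reducible apply HasDerivAt.fun_sub
        | with_reducible apply HasDerivAt.fun_mul | with_reducible apply HasDerivAt.fun_pow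
        | with_reducible apply HasDerivAt.exp
    · ring
  · apply HasDerivAt.congr_deriv
    · repeat' first
        | exact hux x t | exact hpx x t | exact hzx x t
        | exact hasDerivAt_const _ _
        | with_reducible apply HasDerivAt.fun_add | with_reducible apply HasDerivAt.fun_sub
        | with_reducible apply HasDerivAt.fun_mul | with_reducible apply HasDerivAt.fun_pow
        | with_reducible apply HasDerivAt.exp
    · ring
  · apply HasDerivAt.congr_deriv
    · repeat' first
        | exact hpx x t | exact hzx x t
        | exact hasDerivAt_const _ _
        | with_reducible apply HasDerivAt.fun_add | with_reducible apply HasDerivAt.fun_sub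
        | with_reducible apply HasDerivAt.fun_mul | with_reducible apply HasDerivAt.fun_pow
        | with_reducible apply HasDerivAt.exp
    · ring
  · apply HasDerivAt.congr_deriv
    · repeat' first
        | exact hux x t | exact hpx x t | exact hzx x t
        | exact hasDerivAt_const _ _
        | with_reducible apply HasDerivAt.fun_add | with_reducible apply HasDerivAt.fun_sub
        | with_reducible apply HasDerivAt.fun_mul | with_reducible apply HasDerivAt.fun_pow
        | with_reducible apply HasDerivAt.exp
    · unfold Pcub Pder
      linear_combination (2 / 3 * c * ((u x t ^ 3 + c₁ * u x t + c₀) * ((c₁ ^ 2 - 8 * c₀ * u x t)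
        * p x t ^ 2 + 2 * c₁ ^ 2 * p x t + c₁ ^ 2)
        - (3 * u x t ^ 2 + c₁) / 2 * ((c₁ ^ 2 - 4 * c₀ * u x t) * u x t * p x t ^ 2 + 2 * c₁ * (c₁
        * u x t + 2 * c₀) * p x t + c₁ ^ 2 * u x t)) * exp (2 * z x t) / u₁ x t) * hκ
  · apply HasDerivAt.congr_deriv
    · repeat' first
        | exact hux x t | exact hpx x t | exact hzx x t
        | exact hasDerivAt_const _ _
        | with_reducible apply HasDerivAt.fun_add | with_reducible apply HasDerivAt.fun_sub
        | with_reducible apply HasDerivAt.fun_mul | with_reducible apply HasDerivAt.fun_pow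
        | with_reducible apply HasDerivAt.exp
    · unfold Pcub
      linear_combination (2 / 3 * c * ((u x t ^ 3 + c₁ * u x t + c₀) * (-8 * c₀ * p x t ^ 2)
        - u x t * ((c₁ ^ 2 - 4 * c₀ * u x t) * u x t * p x t ^ 2 + 2 * c₁ * (c₁ * u x t + 2 * c₀)
        * p x t + c₁ ^ 2 * u x t)) * exp (2 * z x t) / u₁ x t) * hκ
  · apply HasDerivAt.congr_deriv
    · repeat' first
        | exact hut x t | exact hpt x t | exact hzt x t
        | exact hasDerivAt_const _ _
        | with_reducible apply HasDerivAt.fun_add | with_reducible apply HasDerivAt.fun_sub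
        | with_reducible apply HasDerivAt.fun_mul | with_reducible apply HasDerivAt.fun_pow
        | with_reducible apply HasDerivAt.exp
    · unfold Pcub Pder
      linear_combination (-(4 / 3) * c * ((u x t ^ 3 + c₁ * u x t + c₀) * ((c₁ ^ 2 - 8 * c₀ * u x t)
        * p x t ^ 2 + 2 * c₁ ^ 2 * p x t + c₁ ^ 2)
        - (3 * u x t ^ 2 + c₁) / 2 * ((c₁ ^ 2 - 4 * c₀ * u x t) * u x t * p x t ^ 2 + 2 * c₁ * (c₁
        * u x t + 2 * c₀) * p x t + c₁ ^ 2 * u x t)) * exp (2 * z x t) / u₁ x t) * hκ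
  · apply HasDerivAt.congr_deriv
    · repeat' first
        | exact hut x t | exact hpt x t | exact hzt x t
        | exact hasDerivAt_const _ _
        | with_reducible apply HasDerivAt.fun_add | with_reducible apply HasDerivAt.fun_sub
        | with_reducible apply HasDerivAt.fun_mul | with_reducible apply HasDerivAt.fun_pow
        | with_reducible apply HasDerivAt.exp
    · unfold Pcub Pder
      linear_combination (4 / 3 * c * (2 * u x t * ((c₁ ^ 2 - 4 * c₀ * u x t) * u x t * p x t ^ 2
        + 2 * c₁ * (c₁ * u x t + 2 * c₀) * p x t + c₁ ^ 2 * u x t)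
        - (3 * u x t ^ 2 + c₁) / 2 * ((c₁ ^ 2 - 8 * c₀ * u x t) * p x t ^ 2 + 2 * c₁ ^ 2 * p x t
        + c₁ ^ 2)) * exp (2 * z x t) / u₁ x t) * hκ

end Jets

/-- `γ₄` is a nonlocal cosymmetry of the Krichever–Novikov
equation: `D_t(γ₄) + Σ_k (-Dₓ)ᵏ((∂G₁/∂u_{kx})γ₄) = 0`, with total derivatives
extended to the nonlocal variables by the covering equations. -/
theorem gamma4_is_nonlocal_cosymmetry (c₀ c₁ : ℝ) (hc₀ : 0 < c₀) (hc₁ : c₁ ≠ 0)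
    (u p1 z1 p2 z2 : ℝ → ℝ → ℝ)
    (hu : ContDiff ℝ (⊤ : ℕ∞) (Function.uncurry u))
    (hp1s : ContDiff ℝ (⊤ : ℕ∞) (Function.uncurry p1))
    (hz1s : ContDiff ℝ (⊤ : ℕ∞) (Function.uncurry z1))
    (hp2s : ContDiff ℝ (⊤ : ℕ∞) (Function.uncurry p2))
    (hz2s : ContDiff ℝ (⊤ : ℕ∞) (Function.uncurry z2))
    (hux : ∀ x t, Dx u x t ≠ 0)
    (hKN : ∀ x t, Dt u x t = G1 c₀ c₁ u x t)
    (hp1x : ∀ x t, Dx p1 x t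
      = k3 c₀ c₁ u x t * (p1 x t) ^ 2 + 2 * k1 c₀ c₁ u x t * p1 x t - k2 c₀ c₁ u x t)
    (hp1t : ∀ x t, Dt p1 x t
      = l3 c₀ c₁ u x t * (p1 x t) ^ 2 + 2 * l1 c₀ c₁ u x t * p1 x t - l2 c₀ c₁ u x t)
    (hz1x : ∀ x t, Dx z1 x t = -(k1 c₀ c₁ u x t + p1 x t * k3 c₀ c₁ u x t))
    (hz1t : ∀ x t, Dt z1 x t = -(l1 c₀ c₁ u x t + p1 x t * l3 c₀ c₁ u x t))
    (hp2x : ∀ x t, Dx p2 x t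
      = -(k3 c₀ c₁ u x t * (p2 x t) ^ 2) - 2 * k1 c₀ c₁ u x t * p2 x t + k2 c₀ c₁ u x t)
    (hp2t : ∀ x t, Dt p2 x t
      = -((l3 c₀ c₁ u x t - mco c₀ c₁ u x t) * (p2 x t) ^ 2)
        - (4 * (u x t) ^ 2 / (3 * Dx u x t) + 2 * l1 c₀ c₁ u x t) * p2 x t
        - 2 * c₁ / (3 * Dx u x t) + l2 c₀ c₁ u x t)
    (hz2x : ∀ x t, Dx z2 x t = k1 c₀ c₁ u x t + p2 x t * k3 c₀ c₁ u x t)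
    (hz2t : ∀ x t, Dt z2 x t
      = l1 c₀ c₁ u x t + 2 * (u x t) ^ 2 / (3 * Dx u x t)
        + p2 x t * (l3 c₀ c₁ u x t - mco c₀ c₁ u x t))
    : ∀ x t, Dt (gamma4 c₀ c₁ u p1 z1 p2 z2) x t
        + adjFrG1 c₀ c₁ u (gamma4 c₀ c₁ u p1 z1 p2 z2) x t = 0 := by
  have contDiff_u₁ := contDiff_Dx hu
  have contDiff_u₂ := contDiff_Dx contDiff_u₁
  have contDiff_u₃ := contDiff_Dx contDiff_u₂
  have contDiff_u₄ := contDiff_Dx contDiff_u₃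
  have hKN' : Dt u = G1 c₀ c₁ u := funext fun x => funext fun t => hKN x t
  have hut : HasDt u (G1 c₀ c₁ u) := hKN' ▸ hasDt_Dt hu
  have sqrt_c₀_sq : √c₀ ^ 2 = c₀ := sq_sqrt hc₀.le
  have sqrt_c₀_ne : √c₀ ≠ 0 := (sqrt_pos.2 hc₀).ne'
  have sqrt_six_sq : √(6 : ℝ) ^ 2 = 6 := sq_sqrt (by norm_num)
  have hκ : 24 * c₁ ^ 2 * c₀ * (√6 / (12 * c₁ * √c₀)) ^ 2 = 1 := by
    rw [div_pow, mul_pow, mul_pow, sqrt_six_sq, sqrt_c₀_sq]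
    field_simp
    norm_num
  have sol₁ := isLinearSolution_of_covering (u₁ := Dx u) (u₂ := Dx (Dx u))
    (u₃ := Dx (Dx (Dx u))) (p := p1) (z := z1) (-1 / (2 * c₁ ^ 2)) hκ (hasDx_Dx hu) hut
    (fun x t => (hasDx_Dx hp1s x t).congr_deriv (by
      have hx := hux x t
      rw [hp1x]
      unfold k1 k2 k3 quad
      field_simp
      ring))
    (fun x t => (hasDx_Dx hz1s x t).congr_deriv (by
      have hx := hux x t
      rw [hz1x]
      unfold k1 k3
      field_simp
      ring))
    (fun x t => (hasDt_Dt hp1s x t).congr_deriv (by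
      have hx := hux x t
      rw [hp1t]
      unfold l1 l2 l3 quad quadU quadW Pcub
      generalize √c₀ = b at *
      subst sqrt_c₀_sq
      field_simp
      ring))
    (fun x t => (hasDt_Dt hz1s x t).congr_deriv (by
      have hx := hux x t
      rw [hz1t]
      unfold l1 l3 Pcub
      generalize √c₀ = b at *
      subst sqrt_c₀_sq
      field_simp
      ring))
  have sol₂ := isLinearSolution_of_covering (u₁ := Dx u) (u₂ := Dx (Dx u))
    (u₃ := Dx (Dx (Dx u))) (p := p2) (z := z2) (-1 / (2 * c₁ ^ 2))
    (κ := -(√6 / (12 * c₁ * √c₀))) (by rwa [neg_sq]) (hasDx_Dx hu) hut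
    (fun x t => (hasDx_Dx hp2s x t).congr_deriv (by
      have hx := hux x t
      rw [hp2x]
      unfold k1 k2 k3 quad
      field_simp
      ring))
    (fun x t => (hasDx_Dx hz2s x t).congr_deriv (by
      have hx := hux x t
      rw [hz2x]
      unfold k1 k3
      field_simp
      ring))
    (fun x t => (hasDt_Dt hp2s x t).congr_deriv (by
      have hx := hux x t
      rw [hp2t]
      unfold l1 l2 l3 mco quad quadU quadW Pcub
      generalize √c₀ = b at *
      subst sqrt_c₀_sq
      linear_combination (norm := (field_simp; ring)) (1 / 9 * ((2 * c₁ * u x t ^ 2 - c₁ ^ 2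
        + 8 * b ^ 2 * u x t) * p2 x t ^ 2 + 2 * c₁ * u x t ^ 2 * p2 x t + c₁ ^ 2)
        / (c₁ * Dx u x t)) * sqrt_six_sq))
    (fun x t => (hasDt_Dt hz2s x t).congr_deriv (by
      have hx := hux x t
      rw [hz2t]
      unfold l1 l3 mco Pcub
      generalize √c₀ = b at *
      subst sqrt_c₀_sq
      linear_combination (norm := (field_simp; ring)) (-(1 / 9) * ((2 * c₁ * u x t ^ 2 - c₁ ^ 2
        + 8 * b ^ 2 * u x t) * p2 x t + c₁ * u x t ^ 2) / (c₁ * Dx u x t)) * sqrt_six_sq))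
  have sol := (sol₁.add sol₂).cosymmetry hu hKN' hux (hasDx_Dx hu) (hasDx_Dx contDiff_u₁)
    (hasDx_Dx contDiff_u₂) (hasDx_Dx contDiff_u₃) (hasDx_Dx contDiff_u₄)
  convert sol using 5 <;>
  · funext x t
    have hx := hux x t
    unfold gamma4 quad quadU
    field_simp
    ring
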